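/- For every integer n ≥ 1 and every integer k with 1 ≤ k ≤ 4n−1, the rational number 10^k·A_{−k}(n) is an integer. -/

import Mathlib

/-- `A j n`: the Laurent coefficient of `(x+5)^{-(j+1)}` of `R_n` at `x = -5`, i.e.
`(1/(3n-j)!) (d/dx)^{3n-j} [(x+5)^{3n+1} R_n(x)]` at `x = -5`, where
`(x+5)^{3n+1} R_n(x) = 5 x^{2n} (x⁴+6x²+25)^{2n} / (5-x)^{3n+1}`. -/
noncomputable def A (n : ℕ) (j : ℤ) : ℂ :=
  (1 / ((3 * (n : ℤ) - j).toNat.factorial : ℂ)) *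
    iteratedDeriv (3 * (n : ℤ) - j).toNat
      (fun x : ℂ =>
        5 * x ^ (2 * n) * (x ^ 4 + 6 * x ^ 2 + 25) ^ (2 * n) / (5 - x) ^ (3 * n + 1))
      (-5)

/-- The function `f` is smooth at `a` and, after rescaling the increment by `r`, all its Taylor
coefficients at `a` are integers. -/
def HasIntegralTaylor (r a : ℂ) (f : ℂ → ℂ) : Prop :=
  (∀ m : ℕ, ContDiffAt ℂ m f a) ∧
    ∀ m : ℕ, ∃ z : ℤ, r ^ m * iteratedDeriv m f a = (m.factorial : ℂ) * z

namespace HasIntegralTaylor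

variable {r a : ℂ} {f g : ℂ → ℂ}

theorem intCast (c : ℤ) : HasIntegralTaylor r a (fun _ => (c : ℂ)) := by
  refine ⟨fun m => contDiffAt_const, fun m => ?_⟩
  rw [iteratedDeriv_const]
  rcases eq_or_ne m 0 with rfl | hm
  · exact ⟨c, by simp⟩
  · exact ⟨0, by simp [hm]⟩

theorem add (hf : HasIntegralTaylor r a f) (hg : HasIntegralTaylor r a g) :
    HasIntegralTaylor r a (fun x => f x + g x) := by
  refine ⟨fun m => (hf.1 m).add (hg.1 m), fun m => ?_⟩
  obtain ⟨y, hy⟩ := hf.2 m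
  obtain ⟨z, hz⟩ := hg.2 m
  refine ⟨y + z, ?_⟩
  rw [iteratedDeriv_fun_add (hf.1 m) (hg.1 m), mul_add, hy, hz]
  push_cast
  ring

theorem mul (hf : HasIntegralTaylor r a f) (hg : HasIntegralTaylor r a g) :
    HasIntegralTaylor r a (fun x => f x * g x) := by
  refine ⟨fun m => (hf.1 m).mul (hg.1 m), fun m => ?_⟩
  choose y hy using hf.2
  choose z hz using hg.2
  refine ⟨∑ i ∈ Finset.range (m + 1), y i * z (m - i), ?_⟩
  rw [iteratedDeriv_fun_mul (hf.1 m) (hg.1 m)]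
  push_cast
  rw [Finset.mul_sum, Finset.mul_sum]
  refine Finset.sum_congr rfl fun i hi => ?_
  have him : i ≤ m := Nat.lt_succ_iff.mp (Finset.mem_range.mp hi)
  have hr : r ^ m = r ^ i * r ^ (m - i) := by rw [← pow_add, Nat.add_sub_cancel' him]
  rw [← Nat.choose_mul_factorial_mul_factorial him, hr]
  push_cast
  linear_combination (m.choose i : ℂ) * (r ^ (m - i) * iteratedDeriv (m - i) g a) * hy i +
    (m.choose i : ℂ) * (i.factorial * y i) * hz (m - i)

theorem pow (hf : HasIntegralTaylor r a f) (k : ℕ) :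
    HasIntegralTaylor r a (fun x => f x ^ k) := by
  induction k with
  | zero => simpa using intCast (r := r) (a := a) 1
  | succ k ih => simpa only [pow_succ] using ih.mul hf

end HasIntegralTaylor

/-- The rescaled increment has integral Taylor coefficients. -/
theorem hasIntegralTaylor_increment (a : ℂ) {r : ℂ} (hr : r ≠ 0) :
    HasIntegralTaylor r a (fun x => (x - a) / r) := by
  refine ⟨fun m => by fun_prop, fun m => ?_⟩
  have hd : deriv (fun x : ℂ => (x - a) / r) = fun _ => 1 / r := by
    funext x
    simp
  match m with
  | 0 => exact ⟨0, by simp⟩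
  | 1 => exact ⟨1, by simp [hr]⟩
  | m + 2 => exact ⟨0, by rw [iteratedDeriv_succ', hd, iteratedDeriv_const]; simp⟩

/-- The geometric series in the rescaled increment has integral Taylor coefficients. -/
theorem hasIntegralTaylor_geometric (a : ℂ) {r : ℂ} (hr : r ≠ 0) :
    HasIntegralTaylor r a (fun x => (1 - (x - a) / r)⁻¹) := by
  refine ⟨fun m => ?_, fun m => ⟨1, ?_⟩⟩
  · exact ContDiffAt.inv (by fun_prop) (by simp)
  · have hlin : (fun x : ℂ => (1 - (x - a) / r)⁻¹) =
        fun x => (-r⁻¹ * x + (1 + a / r))⁻¹ := by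
      funext x
      congr 1
      ring
    rw [hlin, iteratedDeriv_eq_iterate, iter_deriv_inv_linear]
    have hone : -r⁻¹ * a + (1 + a / r) = 1 := by ring
    have hsign : (-1 : ℂ) ^ m * (-1) ^ m = 1 := by rw [← mul_pow]; simp
    have hscale : r ^ m * (r⁻¹) ^ m = 1 := by rw [← mul_pow, mul_inv_cancel₀ hr, one_pow]
    simp only [hone, one_zpow, neg_pow r⁻¹ m]
    push_cast
    linear_combination (m.factorial : ℂ) * r ^ m * (r⁻¹) ^ m * hsign +
      (m.factorial : ℂ) * hscale

/-- In the variable `s = (x + 5) / 10`, the integrand is `10 ^ (3 * n)` times an integral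
polynomial in `s` and `(1 - s)⁻¹`. -/
theorem integrand_eq (n : ℕ) (hn : 1 ≤ n) (x : ℂ) :
    5 * x ^ (2 * n) * (x ^ 4 + 6 * x ^ 2 + 25) ^ (2 * n) / (5 - x) ^ (3 * n + 1) =
      10 ^ (3 * n) * (((2 ^ (2 * n - 1) : ℤ) : ℂ) *
        (((2 : ℤ) : ℂ) * ((x - -5) / 10) + ((-1 : ℤ) : ℂ)) ^ (2 * n) *
        (((2 : ℤ) : ℂ) + ((14 : ℤ) : ℂ) * (((x - -5) / 10) ^ 2 + ((-1 : ℤ) : ℂ) * ((x - -5) / 10))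
          + ((25 : ℤ) : ℂ) * (((x - -5) / 10) ^ 2 + ((-1 : ℤ) : ℂ) * ((x - -5) / 10)) ^ 2) ^ (2 * n)
        * ((1 - (x - -5) / 10)⁻¹) ^ (3 * n + 1)) := by
  obtain ⟨s, rfl⟩ : ∃ s : ℂ, x = 10 * s - 5 := ⟨(x + 5) / 10, by ring⟩
  have hs : (10 * s - 5 - -5) / 10 = s := by ring
  obtain ⟨k, rfl⟩ : ∃ k, n = k + 1 := ⟨n - 1, by omega⟩
  have hden : (5 - (10 * s - 5) : ℂ) = 10 * (1 - s) := by ring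
  have hquart : (10 * s - 5) ^ 4 + 6 * (10 * s - 5) ^ 2 + 25 =
      400 * (2 + 14 * (s ^ 2 + -1 * s) + 25 * (s ^ 2 + -1 * s) ^ 2) := by ring
  have hlin : 10 * s - 5 = 5 * (2 * s + -1) := by ring
  have hexp : 2 * (k + 1) - 1 = 2 * k + 1 := by omega
  rw [hs, hden, hquart, hlin, hexp]
  push_cast
  generalize 2 + 14 * (s ^ 2 + -1 * s) + 25 * (s ^ 2 + -1 * s) ^ 2 = q
  generalize 2 * s + -1 = u
  rw [mul_pow, mul_pow, mul_pow, div_eq_mul_inv, mul_inv, inv_pow (1 - s)]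
  have hconst : (5 * 5 ^ (2 * (k + 1)) * 400 ^ (2 * (k + 1)) : ℂ) =
      10 ^ (3 * (k + 1)) * 2 ^ (2 * k + 1) * 10 ^ (3 * (k + 1) + 1) := by
    have h5 : (400 : ℂ) = 2 ^ 4 * 5 ^ 2 := by norm_num
    have h10 : (10 : ℂ) = 2 * 5 := by norm_num
    rw [h5, h10]
    simp only [mul_pow, ← pow_mul]
    ring
  have hne : (10 : ℂ) ^ (3 * (k + 1) + 1) ≠ 0 := pow_ne_zero _ (by norm_num)
  have hcancel := mul_inv_cancel₀ hne
  linear_combination u ^ (2 * (k + 1)) * q ^ (2 * (k + 1)) * ((1 - s) ^ (3 * (k + 1) + 1))⁻¹ *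
    ((10 ^ (3 * (k + 1) + 1))⁻¹ * hconst + 10 ^ (3 * (k + 1)) * 2 ^ (2 * k + 1) * hcancel)

/-- For `n ≥ 1` and `1 ≤ k ≤ 4n - 1`, the rational number `10^k · A_{-k}(n)` is an integer. -/
theorem A_neg_integrality (n : ℕ) (hn : 1 ≤ n) (k : ℕ) (hk1 : 1 ≤ k) (hk2 : k ≤ 4 * n - 1) :
    ∃ m : ℤ, (10 : ℂ) ^ k * A n (-(k : ℤ)) = (m : ℂ) := by
  have h10 : (10 : ℂ) ≠ 0 := by norm_num
  have hs := hasIntegralTaylor_increment (-5) h10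
  have hw := (hs.pow 2).add ((HasIntegralTaylor.intCast (-1)).mul hs)
  have hu := ((HasIntegralTaylor.intCast 2).mul hs).add (.intCast (-1))
  have hq := ((HasIntegralTaylor.intCast 2).add ((HasIntegralTaylor.intCast 14).mul hw)).add
    ((HasIntegralTaylor.intCast 25).mul (hw.pow 2))
  have hg := (((HasIntegralTaylor.intCast (2 ^ (2 * n - 1))).mul (hu.pow (2 * n))).mul
    (hq.pow (2 * n))).mul ((hasIntegralTaylor_geometric (-5) h10).pow (3 * n + 1))
  obtain ⟨z, hz⟩ := hg.2 (3 * n + k)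
  refine ⟨z, ?_⟩
  have hdeg : (3 * (n : ℤ) - -(k : ℤ)).toNat = 3 * n + k := by omega
  have hfact : ((3 * n + k).factorial : ℂ) ≠ 0 := by
    exact_mod_cast (3 * n + k).factorial_ne_zero
  rw [A, hdeg]
  simp only [integrand_eq n hn]
  rw [iteratedDeriv_const_mul_field, one_div]
  rw [pow_add] at hz
  linear_combination ((3 * n + k).factorial : ℂ)⁻¹ * hz + z * inv_mul_cancel₀ hfact
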